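/- arXiv:0810.5285 — 2 statements merged into one kernel-verified Lean document; each statement's English description precedes it below -/
import Mathlib

section
/- Let a, b ∈ (0,∞) and let f ∈ 𝓕 be a solution of the functional equation f(t) = f(at) + f(bt) for all t ≥ 0. Then for all integers i, j ∈ ℤ and every t > 0 one has f(t)² ≤ f(a^{−i} b^{−j} t) · f(a^{i} b^{j} t). -/
/-- `𝓕`: continuous functions `f : [0,∞) → ℝ` with `f 0 = 0` and `0` an isolated
point of the zero set `{x ≥ 0 : f x = 0}`. -/
def MemClassF (f : ℝ → ℝ) : Prop :=
  ContinuousOn f (Set.Ici 0) ∧ f 0 = 0 ∧ ∃ u > (0:ℝ), ∀ x, 0 < x → x < u → f x ≠ 0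

open Finset Filter Topology

/-- The `N`-th discrete approximation of the moment `∫ φ dμ` of the measure on `[0, 1]`
represented by a solution `G` of `G m n = G (m + 1) n + G m (n + 1)`. -/
noncomputable def bernsteinMoment (G : ℕ → ℕ → ℝ) (φ : ℝ → ℝ) (N : ℕ) : ℝ :=
  ∑ k ∈ range (N + 1), (N.choose k : ℝ) * G k (N - k) * φ ((k : ℝ) / N)

lemma sum_choose_mul_eq_of_rec (N : ℕ) (G : ℕ → ℕ → ℝ)
    (hG : ∀ m n, G m n = G (m + 1) n + G m (n + 1)) :
    ∑ k ∈ range (N + 1), (N.choose k : ℝ) * G k (N - k) = G 0 0 := by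
  induction N generalizing G with
  | zero => simp
  | succ N ih =>
    rw [Finset.sum_choose_succ_mul, hG 0 0, ← ih (fun m n => G (m + 1) n) fun m n => hG _ _,
      ← ih (fun m n => G m (n + 1)) fun m n => hG _ _, add_comm]
    congr 1
    refine sum_congr rfl fun k hk => ?_
    rw [Nat.sub_add_comm (Nat.lt_succ_iff.mp (mem_range.mp hk))]

lemma bernsteinMoment_pow_succ (G : ℕ → ℕ → ℝ) (m N : ℕ) :
    bernsteinMoment G (fun x => x ^ (m + 1)) (N + 1) =
      ∑ j ∈ range (N + 1), (N.choose j : ℝ) * G (j + 1) (N - j) *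
        (((j + 1 : ℕ) : ℝ) / (N + 1 : ℕ)) ^ m := by
  rw [bernsteinMoment, sum_range_succ']
  simp only [CharP.cast_eq_zero, zero_div, ne_eq, Nat.add_eq_zero_iff, one_ne_zero, and_false,
    not_false_eq_true, zero_pow, mul_zero, add_zero]
  refine sum_congr rfl fun j _ => ?_
  have h : ((N + 1 : ℕ) : ℝ) * N.choose j = (N + 1).choose (j + 1) * ((j + 1 : ℕ) : ℝ) := by
    exact_mod_cast Nat.add_one_mul_choose_eq N j
  have hN : ((N + 1 : ℕ) : ℝ) ≠ 0 := by positivity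
  have h' : (N.choose j : ℝ) = (N + 1).choose (j + 1) * (((j + 1 : ℕ) : ℝ) / (N + 1 : ℕ)) := by
    field_simp
    linarith
  rw [h', pow_succ, Nat.add_sub_add_right]
  ring

lemma abs_succ_div_pow_sub_div_pow_le {j N : ℕ} (hj : j ≤ N) (m : ℕ) :
    |(((j + 1 : ℕ) : ℝ) / (N + 1 : ℕ)) ^ m - ((j : ℝ) / N) ^ m| ≤ m / ((N : ℝ) + 1) := by
  have hjN : (j : ℝ) ≤ N := by exact_mod_cast hj
  have hx0 : 0 ≤ ((j + 1 : ℕ) : ℝ) / (N + 1 : ℕ) := by positivity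
  have hx1 : ((j + 1 : ℕ) : ℝ) / (N + 1 : ℕ) ≤ 1 :=
    div_le_one_of_le₀ (by push_cast; linarith) (by positivity)
  have hy0 : 0 ≤ (j : ℝ) / N := by positivity
  have hy1 : (j : ℝ) / N ≤ 1 := div_le_one_of_le₀ hjN (by positivity)
  have hd : |((j + 1 : ℕ) : ℝ) / (N + 1 : ℕ) - (j : ℝ) / N| ≤ 1 / ((N : ℝ) + 1) := by
    have key : ((j + 1 : ℕ) : ℝ) / (N + 1 : ℕ) - (j : ℝ) / N = (1 - (j : ℝ) / N) / (N + 1) := by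
      rcases Nat.eq_zero_or_pos N with rfl | hN
      · simp [Nat.le_zero.mp hj]
      · have : (N : ℝ) ≠ 0 := by positivity
        push_cast
        field_simp
        ring
    rw [key, abs_of_nonneg (div_nonneg (by linarith) (by positivity))]
    gcongr
    linarith
  calc _ ≤ _ := abs_pow_sub_pow_le _ _ _
    _ ≤ 1 / ((N : ℝ) + 1) * m * 1 ^ (m - 1) := by
        gcongr
        rw [abs_of_nonneg hx0, abs_of_nonneg hy0]
        exact max_le hx1 hy1
    _ = _ := by rw [one_pow]; ring

lemma tendsto_bernsteinMoment_pow (m : ℕ) (G : ℕ → ℕ → ℝ) (hpos : ∀ m n, 0 ≤ G m n)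
    (hG : ∀ m n, G m n = G (m + 1) n + G m (n + 1)) :
    Tendsto (bernsteinMoment G fun x => x ^ m) atTop (𝓝 (G m 0)) := by
  induction m generalizing G with
  | zero =>
    refine tendsto_const_nhds.congr fun N => ?_
    simp [bernsteinMoment, sum_choose_mul_eq_of_rec N G hG]
  | succ m ih =>
    rw [← tendsto_add_atTop_iff_nat 1]
    have hlim := ih (fun m n => G (m + 1) n) (fun _ _ => hpos _ _) fun _ _ => hG _ _
    have herr : Tendsto (fun N : ℕ => (m : ℝ) / ((N : ℝ) + 1) * G 1 0) atTop (𝓝 0) := by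
      have := (tendsto_one_div_add_atTop_nhds_zero_nat (𝕜 := ℝ)).const_mul (m * G 1 0)
      rw [mul_zero] at this
      exact this.congr fun N => by ring
    have hdiff : Tendsto (fun N : ℕ => bernsteinMoment G (fun x => x ^ (m + 1)) (N + 1) -
        bernsteinMoment (fun m n => G (m + 1) n) (fun x => x ^ m) N) atTop (𝓝 0) := by
      refine squeeze_zero_norm (fun N => ?_) herr
      rw [bernsteinMoment_pow_succ, bernsteinMoment, ← sum_sub_distrib, Real.norm_eq_abs,
        ← sum_choose_mul_eq_of_rec N (fun m n => G (m + 1) n) fun _ _ => hG _ _, mul_sum]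
      refine (abs_sum_le_sum_abs _ _).trans (sum_le_sum fun j hj => ?_)
      have hw : 0 ≤ (N.choose j : ℝ) * G (j + 1) (N - j) :=
        mul_nonneg (by positivity) (hpos _ _)
      rw [← mul_sub, abs_mul, abs_of_nonneg hw, mul_comm]
      exact mul_le_mul_of_nonneg_right
        (abs_succ_div_pow_sub_div_pow_le (Nat.lt_succ_iff.mp (mem_range.mp hj)) m) hw
    simpa using hdiff.add hlim

lemma tendsto_bernsteinMoment (m n : ℕ) (G : ℕ → ℕ → ℝ) (hpos : ∀ m n, 0 ≤ G m n)
    (hG : ∀ m n, G m n = G (m + 1) n + G m (n + 1)) :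
    Tendsto (bernsteinMoment G fun x => x ^ m * (1 - x) ^ n) atTop (𝓝 (G m n)) := by
  induction n generalizing m with
  | zero => simpa using tendsto_bernsteinMoment_pow m G hpos hG
  | succ n ih =>
    have h := (ih m).sub (ih (m + 1))
    rw [hG m n, add_sub_cancel_left] at h
    refine h.congr fun N => ?_
    simp only [bernsteinMoment]
    rw [← sum_sub_distrib]
    exact sum_congr rfl fun k _ => by ring

lemma sq_le_mul_of_rec (G : ℕ → ℕ → ℝ) (hpos : ∀ m n, 0 ≤ G m n)
    (hG : ∀ m n, G m n = G (m + 1) n + G m (n + 1)) {p₁ p₂ q₁ q₂ r₁ r₂ : ℕ}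
    (h₁ : p₁ + r₁ = 2 * q₁) (h₂ : p₂ + r₂ = 2 * q₂) :
    G q₁ q₂ ^ 2 ≤ G p₁ p₂ * G r₁ r₂ := by
  refine le_of_tendsto_of_tendsto' ((tendsto_bernsteinMoment q₁ q₂ G hpos hG).pow 2)
    ((tendsto_bernsteinMoment p₁ p₂ G hpos hG).mul (tendsto_bernsteinMoment r₁ r₂ G hpos hG))
    fun N => ?_
  have hnn : ∀ m n : ℕ, ∀ k ∈ range (N + 1), 0 ≤ (N.choose k : ℝ) * G k (N - k) *
      (((k : ℝ) / N) ^ m * (1 - (k : ℝ) / N) ^ n) := fun m n k hk => by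
    have hk' : (k : ℝ) ≤ N := by exact_mod_cast Nat.lt_succ_iff.mp (mem_range.mp hk)
    have h1 : 0 ≤ 1 - (k : ℝ) / N := sub_nonneg.mpr (div_le_one_of_le₀ hk' (by positivity))
    have := hpos k (N - k)
    positivity
  refine sum_sq_le_sum_mul_sum_of_sq_le_mul _ (hnn _ _) (hnn _ _) fun k _ => le_of_eq ?_
  generalize (k : ℝ) / N = x
  have e₁ : x ^ p₁ * x ^ r₁ = (x ^ q₁) ^ 2 := by rw [← pow_add, h₁, mul_comm, pow_mul]
  have e₂ : (1 - x) ^ p₂ * (1 - x) ^ r₂ = ((1 - x) ^ q₂) ^ 2 := by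
    rw [← pow_add, h₂, mul_comm, pow_mul]
  rw [mul_pow, mul_pow (x ^ q₁), ← e₁, ← e₂]
  ring

lemma lt_one_of_pos_near_zero {a b : ℝ} (ha : 0 < a) (hb : 0 < b) {f : ℝ → ℝ}
    (hc : ContinuousOn f (Set.Ici 0)) (h0 : f 0 = 0)
    (heq : ∀ t : ℝ, 0 ≤ t → f t = f (a * t) + f (b * t))
    {u : ℝ} (hu : 0 < u) (hpos : ∀ x, 0 < x → x < u → 0 < f x) : a < 1 := by
  by_contra! h1
  obtain ⟨s, hs, hsu⟩ := exists_between (show 0 < min u (u / b) by positivity)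
  have hsu1 : s < u := hsu.trans_le (min_le_left _ _)
  have hsu2 : s * b < u := (lt_div_iff₀ hb).mp (hsu.trans_le (min_le_right _ _))
  obtain ⟨x, hx, hmax⟩ := isCompact_Icc.exists_isMaxOn (Set.nonempty_Icc.mpr hs.le)
    (hc.mono Set.Icc_subset_Ici_self)
  have hfs := hpos s hs hsu1
  have hsx : f s ≤ f x := hmax (Set.right_mem_Icc.mpr hs.le)
  have hx0 : 0 < x := lt_of_le_of_ne hx.1 (by rintro rfl; linarith)
  have hxa : 0 < x / a := by positivity
  have hxs : x / a ≤ s := (div_le_self hx.1 h1).trans hx.2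
  have hle : f (x / a) ≤ f x := hmax ⟨hxa.le, hxs⟩
  have hbx : 0 < f (b * (x / a)) := hpos _ (by positivity) (by nlinarith)
  have := heq (x / a) hxa.le
  rw [mul_div_cancel₀ x ha.ne'] at this
  linarith

lemma pos_of_pos_near_zero {a b : ℝ} (ha : 0 < a) (hb : 0 < b) {f : ℝ → ℝ}
    (hc : ContinuousOn f (Set.Ici 0)) (h0 : f 0 = 0)
    (heq : ∀ t : ℝ, 0 ≤ t → f t = f (a * t) + f (b * t))
    {u : ℝ} (hu : 0 < u) (hpos : ∀ x, 0 < x → x < u → 0 < f x) {t : ℝ} (ht : 0 < t) :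
    0 < f t := by
  have ha1 := lt_one_of_pos_near_zero ha hb hc h0 heq hu hpos
  have hb1 := lt_one_of_pos_near_zero hb ha hc h0
    (fun t ht => (heq t ht).trans (add_comm _ _)) hu hpos
  have hc0 : 0 < max a b := lt_max_of_lt_left ha
  have key : ∀ n : ℕ, ∀ t, 0 < t → max a b ^ n * t < u → 0 < f t := by
    intro n
    induction n with
    | zero => intro t ht h; exact hpos t ht (by simpa using h)
    | succ n ih =>
      intro t ht h
      rw [pow_succ, mul_assoc] at h
      rw [heq t ht.le]
      refine add_pos (ih _ (by positivity) (lt_of_le_of_lt ?_ h))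
        (ih _ (by positivity) (lt_of_le_of_lt ?_ h))
      · gcongr
        exact le_max_left _ _
      · gcongr
        exact le_max_right _ _
  obtain ⟨n, hn⟩ := exists_pow_lt_of_lt_one (show 0 < u / t by positivity) (max_lt ha1 hb1)
  exact key n t ht ((lt_div_iff₀ ht).mp hn)

lemma sq_le_mul_of_pos {a b : ℝ} (ha : 0 < a) (hb : 0 < b) {f : ℝ → ℝ}
    (heq : ∀ t : ℝ, 0 ≤ t → f t = f (a * t) + f (b * t)) (hpos : ∀ t, 0 < t → 0 < f t)
    (i j : ℤ) {t : ℝ} (ht : 0 < t) :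
    f t ^ 2 ≤ f (a ^ (-i) * b ^ (-j) * t) * f (a ^ i * b ^ j * t) := by
  obtain ⟨I, p₁, r₁, hp₁, hr₁⟩ : ∃ I p₁ r₁ : ℕ, (p₁ : ℤ) = I + -i ∧ (r₁ : ℤ) = I + i :=
    ⟨i.natAbs, (i.natAbs + -i).toNat, (i.natAbs + i).toNat, by omega, by omega⟩
  obtain ⟨J, p₂, r₂, hp₂, hr₂⟩ : ∃ J p₂ r₂ : ℕ, (p₂ : ℤ) = J + -j ∧ (r₂ : ℤ) = J + j :=
    ⟨j.natAbs, (j.natAbs + -j).toNat, (j.natAbs + j).toNat, by omega, by omega⟩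
  have hmul : ∀ (m n : ℕ) (k l : ℤ), (m : ℤ) = I + k → (n : ℤ) = J + l →
      a ^ m * b ^ n * (t / (a ^ I * b ^ J)) = a ^ k * b ^ l * t := by
    intro m n k l hm hn
    rw [← zpow_natCast a m, ← zpow_natCast b n, hm, hn, zpow_add₀ ha.ne', zpow_add₀ hb.ne',
      zpow_natCast, zpow_natCast]
    field_simp
  have key := sq_le_mul_of_rec (fun m n => f (a ^ m * b ^ n * (t / (a ^ I * b ^ J))))
    (fun m n => (hpos _ (by positivity)).le)
    (fun m n => by
      rw [heq _ (by positivity)]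
      congr 2 <;> ring)
    (show p₁ + r₁ = 2 * I by omega) (show p₂ + r₂ = 2 * J by omega)
  rw [hmul p₁ p₂ _ _ hp₁ hp₂, hmul r₁ r₂ _ _ hr₁ hr₂, hmul I J 0 0 (by simp) (by simp)] at key
  simpa using key

lemma pos_or_neg_of_ne_zero {f : ℝ → ℝ} {u : ℝ} (hc : ContinuousOn f (Set.Ioo 0 u))
    (hne : ∀ x, 0 < x → x < u → f x ≠ 0) :
    (∀ x, 0 < x → x < u → 0 < f x) ∨ ∀ x, 0 < x → x < u → f x < 0 := by
  by_contra! h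
  obtain ⟨⟨x, hx, hxu, hfx⟩, y, hy, hyu, hfy⟩ := h
  obtain ⟨z, hz, hfz⟩ := isPreconnected_Ioo.intermediate_value ⟨hx, hxu⟩ ⟨hy, hyu⟩ hc ⟨hfx, hfy⟩
  exact hne z hz.1 hz.2 hfz

theorem stmt_6 (a b : ℝ) (ha : 0 < a) (hb : 0 < b) (f : ℝ → ℝ)
    (hf : MemClassF f) (heq : ∀ t : ℝ, 0 ≤ t → f t = f (a * t) + f (b * t)) :
    ∀ (i j : ℤ) (t : ℝ), 0 < t →
      (f t) ^ 2 ≤ f (a ^ (-i) * b ^ (-j) * t) * f (a ^ i * b ^ j * t) := by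
  intro i j t ht
  obtain ⟨hc, h0, u, hu, hne⟩ := hf
  rcases pos_or_neg_of_ne_zero (hc.mono fun x hx => hx.1.le) hne with hpos | hneg
  · exact sq_le_mul_of_pos ha hb heq
      (fun s hs => pos_of_pos_near_zero ha hb hc h0 heq hu hpos hs) i j ht
  · have heq' : ∀ t : ℝ, 0 ≤ t → (-f) t = (-f) (a * t) + (-f) (b * t) := fun t ht => by
      simp only [Pi.neg_apply, heq t ht, neg_add]
    have key := sq_le_mul_of_pos ha hb heq'
      (fun s hs => pos_of_pos_near_zero ha hb hc.neg (by simp [h0]) heq' hu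
        (fun x hx hxu => by simpa using hneg x hx hxu) hs) i j ht
    simpa using key
end

section
/- Let c, d : [0,∞)² → [0,∞) and set Z = {(r,s) ∈ (0,∞)² : d(r,s) = 0}. Assume Z ≠ ∅ and Z ≠ (0,∞)². Let φ, ψ : ℝ → ℝ be nontrivial real-valued characteristic functions of probability measures on ℝ satisfying φ(rt)·φ(st) = φ(c(r,s)·t)·ψ(d(r,s)·t) for all r, s ≥ 0 and all t ∈ ℝ. Then there exist p ∈ (0,2] and even continuous functions H, K : ℝ \ {0} → (0,∞) such that φ(t) = exp(−|t|^p · H(t)) and ψ(t) = exp(−|t|^p · K(t)) for every t ≠ 0; moreover H(rt) = H(st) = H(c(r,s)·t) and K(rt) = K(st) = K(c(r,s)·t) for every t ≠ 0 and every (r,s) ∈ Z; and r^p·H(rt) + s^p·H(st) = c(r,s)^p·H(c(r,s)·t) + d(r,s)^p·K(d(r,s)·t) for every t ≠ 0 and all r, s > 0 with c(r,s) > 0 and (r,s) ∉ Z. -/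
open MeasureTheory

/-- The characteristic function of a measure `μ` on `ℝ`. -/
noncomputable def charFunOf (μ : Measure ℝ) (t : ℝ) : ℂ :=
  ∫ x, Complex.exp (t * x * Complex.I) ∂μ

/-! ### Positive solutions of a two-point averaging equation -/

/-- A bounded solution of `G x = α G (x + u) + β G (x + v)` satisfies `G (x + u) ≤ G (x + v)`. -/
lemma bounded_averaging_le {G : ℝ → ℝ} {α β u v B : ℝ} (hα : 0 < α) (hβ : 0 < β)
    (hαβ : α + β = 1) (hB : ∀ x, |G x| ≤ B)
    (hG : ∀ x, G x = α * G (x + u) + β * G (x + v)) (x : ℝ) : G (x + u) ≤ G (x + v) := by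
  by_contra! hx
  set D : ℝ → ℝ := fun x => G (x + u) - G (x + v) with hDdef
  have hD : ∀ x, D x = α * D (x + u) + β * D (x + v) := by
    intro x
    simp only [hDdef]
    rw [hG (x + u), hG (x + v), add_right_comm x v u]
    ring
  have hbdd : BddAbove (Set.range D) := by
    refine ⟨2 * B, ?_⟩
    rintro _ ⟨y, rfl⟩
    have h1 := abs_le.1 (hB (y + u))
    have h2 := abs_le.1 (hB (y + v))
    simp only [hDdef]
    linarith
  set S := sSup (Set.range D)
  have hle : ∀ y, D y ≤ S := fun y => le_csSup hbdd ⟨y, rfl⟩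
  have hS : 0 < S := lt_of_lt_of_le (sub_pos.2 hx) (hle x)
  set γ := min α β
  have hγ : 0 < γ := lt_min hα hβ
  have hstep : ∀ y δ, S - δ ≤ D y → S - δ / γ ≤ D (y + u) ∧ S - δ / γ ≤ D (y + v) := by
    intro y δ hy
    have h0 := hD y
    have hu := hle (y + u)
    have hv := hle (y + v)
    have hδ : 0 ≤ δ := by linarith [hle y]
    have key : ∀ w κ, γ ≤ κ → κ * (S - w) ≤ δ → w ≤ S → S - δ / γ ≤ w := by
      intro w κ hκ h1 h2
      have : S - w ≤ δ / γ := by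
        rw [le_div_iff₀ hγ]
        nlinarith
      linarith
    constructor
    · exact key _ α (min_le_left _ _) (by nlinarith) hu
    · exact key _ β (min_le_right _ _) (by nlinarith) hv
  have horbit : ∀ (n : ℕ) (y δ : ℝ), S - δ ≤ D y → ∀ i j : ℕ, i + j = n →
      S - δ / γ ^ n ≤ D (y + (i * u + j * v)) := by
    intro n
    induction n with
    | zero =>
      intro y δ hy i j hij
      obtain ⟨rfl, rfl⟩ : i = 0 ∧ j = 0 := by omega
      simpa using hy
    | succ n ih =>
      intro y δ hy i j hij
      have hs := hstep y δ hy
      have e : δ / γ ^ (n + 1) = δ / γ / γ ^ n := by rw [pow_succ', div_div]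
      rw [e]
      rcases i with _ | i
      · rcases j with _ | j
        · omega
        · convert ih _ _ hs.2 0 j (by omega) using 2
          push_cast; ring
      · convert ih _ _ hs.1 i j (by omega) using 2
        push_cast; ring
  obtain ⟨N, hN⟩ := exists_nat_gt (2 * B / (S / 2))
  have hN' : 2 * B < N * (S / 2) := by rwa [div_lt_iff₀ (by positivity)] at hN
  obtain ⟨_, ⟨y, rfl⟩, hy⟩ := exists_lt_of_lt_csSup (Set.range_nonempty D)
    (show S - S / 2 * γ ^ (N - 1) < S from sub_lt_self _ (by positivity))
  set A : ℕ → ℝ := fun k => G (y + (k * u + (N - k) * v)) with hA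
  have hterm : ∀ k ∈ Finset.range N, S / 2 ≤ A (k + 1) - A k := by
    intro k hk
    have hk := Finset.mem_range.1 hk
    have h := horbit (N - 1) y _ hy.le k (N - 1 - k) (by omega)
    rw [mul_div_cancel_right₀ _ (by positivity)] at h
    have hc : ((N - 1 - k : ℕ) : ℝ) = N - 1 - k := by
      rw [Nat.cast_sub (by omega), Nat.cast_sub (by omega)]; simp
    rw [hc] at h
    have e1 : y + (k * u + ((N : ℝ) - 1 - k) * v) + u
        = y + (((k + 1 : ℕ) : ℝ) * u + (N - ((k + 1 : ℕ) : ℝ)) * v) := by push_cast; ring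
    have e2 : y + (k * u + ((N : ℝ) - 1 - k) * v) + v = y + (k * u + (N - k) * v) := by ring
    simp only [hDdef, e1, e2] at h
    simp only [hA]
    linarith
  have hsum := Finset.sum_le_sum hterm
  rw [Finset.sum_range_sub, Finset.sum_const, Finset.card_range, nsmul_eq_mul] at hsum
  have h1 : A N ≤ B := (abs_le.1 (hB _)).2
  have h2 : -B ≤ A 0 := (abs_le.1 (hB _)).1
  linarith

/-- A nonnegative continuous solution of `g x = α g (x + u) + β g (x + v)`, where `u` and `v` are
positive and `α + β = 1`, is periodic with periods `u` and `v`. -/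
lemma nonneg_averaging_periodic {g : ℝ → ℝ} {α β u v : ℝ} (hα : 0 < α) (hβ : 0 < β)
    (hαβ : α + β = 1) (hu : 0 < u) (hv : 0 < v) (hgc : Continuous g) (hg0 : ∀ x, 0 ≤ g x)
    (hg : ∀ x, g x = α * g (x + u) + β * g (x + v)) (x : ℝ) :
    g (x + u) = g x ∧ g (x + v) = g x := by
  set Γ : ℝ → ℝ := fun x => ∫ y in (0 : ℝ)..x, g y with hΓdef
  have hΓ : ∀ x, HasDerivAt Γ (g x) x := fun x =>
    intervalIntegral.integral_hasDerivAt_right (hgc.intervalIntegrable _ _)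
      (hgc.stronglyMeasurableAtFilter _ _) hgc.continuousAt
  have hΓs : ∀ w x, HasDerivAt (fun x => Γ (x + w)) (g (x + w)) x := fun w x =>
    (hΓ (x + w)).comp_add_const x w
  have hmono : Monotone Γ := monotone_of_hasDerivAt_nonneg hΓ hg0
  set Q : ℝ → ℝ := fun x => α * Γ (x + u) + β * Γ (x + v) - Γ x with hQdef
  have hQ' : ∀ x, HasDerivAt Q 0 x := by
    intro x
    have h := (((hΓs u x).const_mul α).add ((hΓs v x).const_mul β)).sub (hΓ x)
    rwa [← hg x, sub_self] at h
  have hQ : ∀ x y, Q x = Q y :=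
    is_const_of_deriv_eq_zero (fun x => (hQ' x).differentiableAt) (fun x => (hQ' x).deriv)
  set E : ℝ → ℝ := fun x => Γ (x + u) - Γ (x + v) with hEdef
  have hE : ∀ h, 0 < h → h ≤ min u v → ∀ x, E (x + h) = E x := by
    intro h h0 hh x
    have hhu := hh.trans (min_le_left _ _)
    have hhv := hh.trans (min_le_right _ _)
    set G : ℝ → ℝ := fun x => Γ (x + h) - Γ x with hGdef
    have hB : ∀ x, |G x| ≤ Q 0 := by
      intro x
      have h1 : Γ x ≤ Γ (x + h) := hmono (by linarith)
      have h2 : Γ (x + h) ≤ Γ (x + u) := hmono (by linarith)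
      have h3 : Γ (x + h) ≤ Γ (x + v) := hmono (by linarith)
      rw [abs_of_nonneg (sub_nonneg.2 h1), hQ 0 x]
      simp only [hQdef]
      have : Γ (x + h) = α * Γ (x + h) + β * Γ (x + h) := by rw [← add_mul, hαβ, one_mul]
      nlinarith
    have hG : ∀ x, G x = α * G (x + u) + β * G (x + v) := by
      intro x
      have := hQ x (x + h)
      simp only [hQdef] at this
      simp only [hGdef, add_right_comm x u h, add_right_comm x v h]
      linarith
    have h1 := bounded_averaging_le hα hβ hαβ hB hG x
    have h2 := bounded_averaging_le hβ hα (by linarith) hB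
      (fun x => by rw [hG x]; ring) x (u := v) (v := u)
    simp only [hGdef] at h1 h2
    simp only [hEdef, add_right_comm x h u, add_right_comm x h v]
    linarith
  have hEx : E =ᶠ[nhds x] fun _ => E (x - min u v / 2) := by
    have hm : 0 < min u v := lt_min hu hv
    filter_upwards [Ioo_mem_nhds (show x - min u v / 2 < x by linarith)
      (show x < x + min u v / 2 by linarith)] with y hy
    have := hE (y - (x - min u v / 2)) (by linarith [hy.1]) (by linarith [hy.2])
      (x - min u v / 2)
    rwa [add_sub_cancel] at this
  have h0 := (hasDerivAt_const x (E (x - min u v / 2))).congr_of_eventuallyEq hEx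
  have heq := h0.unique ((hΓs u x).sub (hΓs v x))
  have hx := hg x
  have huv : g (x + u) = g (x + v) := by linarith
  have : g x = g (x + u) := by rw [hx, ← huv, ← add_mul, hαβ, one_mul]
  exact ⟨this.symm, by rw [← huv, this]⟩

/-- The exponent `p` with `a ^ p + b ^ p = 1`. -/
lemma exists_rpow_add_rpow_eq_one {a b : ℝ} (ha : 0 < a) (ha1 : a < 1) (hb : 0 < b)
    (hb1 : b < 1) : ∃ p : ℝ, 0 < p ∧ a ^ p + b ^ p = 1 := by
  have hcont : Continuous fun p : ℝ => a ^ p + b ^ p :=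
    (Real.continuous_const_rpow ha.ne').add (Real.continuous_const_rpow hb.ne')
  have hlim : Filter.Tendsto (fun p : ℝ => a ^ p + b ^ p) Filter.atTop (nhds (0 + 0)) :=
    (tendsto_rpow_atTop_of_base_lt_one a (by linarith) ha1).add
      (tendsto_rpow_atTop_of_base_lt_one b (by linarith) hb1)
  rw [add_zero] at hlim
  obtain ⟨P, hP1, hP0⟩ := ((hlim.eventually_lt_const one_pos).and
    (Filter.eventually_ge_atTop 0)).exists
  obtain ⟨p, hp, hp1⟩ := intermediate_value_Icc' hP0 hcont.continuousOn
    (show (1 : ℝ) ∈ Set.Icc _ _ from ⟨hP1.le, by norm_num⟩)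
  refine ⟨p, lt_of_le_of_ne hp.1 ?_, hp1⟩
  rintro rfl
  norm_num at hp1

/-- A nonnegative continuous solution of `f t = f (a t) + f (b t)` scales like `t ^ p`
under `a` and `b`. -/
lemma exists_scaling_exponent {f : ℝ → ℝ} {a b : ℝ} (hfc : Continuous f) (hf0 : ∀ t, 0 ≤ f t)
    (ha : 0 < a) (ha1 : a < 1) (hb : 0 < b) (hb1 : b < 1)
    (hf : ∀ t, f t = f (a * t) + f (b * t)) :
    ∃ p : ℝ, 0 < p ∧ ∀ t, 0 < t → f (a * t) = a ^ p * f t ∧ f (b * t) = b ^ p * f t := by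
  obtain ⟨p, hp, hab⟩ := exists_rpow_add_rpow_eq_one ha ha1 hb hb1
  refine ⟨p, hp, fun t ht => ?_⟩
  set g : ℝ → ℝ := fun x => f (Real.exp (-x)) * Real.exp (p * x) with hgdef
  have hshift : ∀ q, 0 < q → ∀ x,
      q ^ p * g (x + -Real.log q) = f (q * Real.exp (-x)) * Real.exp (p * x) := by
    intro q hq x
    have e1 : Real.exp (-(x + -Real.log q)) = q * Real.exp (-x) := by
      rw [neg_add, neg_neg, Real.exp_add, Real.exp_log hq, mul_comm]
    have e2 : q ^ p * Real.exp (p * (x + -Real.log q)) = Real.exp (p * x) := by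
      rw [Real.rpow_def_of_pos hq, ← Real.exp_add]
      congr 1; ring
    simp only [hgdef]
    rw [e1, ← e2]; ring
  have hper := nonneg_averaging_periodic (g := g) (Real.rpow_pos_of_pos ha p)
    (Real.rpow_pos_of_pos hb p) hab (neg_pos.2 (Real.log_neg ha ha1))
    (neg_pos.2 (Real.log_neg hb hb1)) (by fun_prop)
    (fun x => mul_nonneg (hf0 _) (Real.exp_pos _).le)
    (fun x => by rw [hshift a ha, hshift b hb, ← add_mul, ← hf]) (-Real.log t)
  have key : ∀ q, 0 < q → g (-Real.log t + -Real.log q) = g (-Real.log t) →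
      f (q * t) = q ^ p * f t := by
    intro q hq h
    have h1 := hshift q hq (-Real.log t)
    rw [h] at h1
    simp only [hgdef, neg_neg, Real.exp_log ht] at h1
    rw [← mul_assoc] at h1
    exact (mul_right_cancel₀ (Real.exp_pos _).ne' h1).symm
  exact ⟨key a ha hper.1, key b hb hper.2⟩

lemma scaling_iterate {f : ℝ → ℝ} {a p : ℝ} (ha : 0 < a)
    (hf : ∀ t, 0 < t → f (a * t) = a ^ p * f t) (n : ℕ) (t : ℝ) (ht : 0 < t) :
    f (a ^ n * t) = (a ^ p) ^ n * f t := by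
  induction n with
  | zero => simp
  | succ n ih => rw [pow_succ', mul_assoc, hf _ (by positivity), ih, pow_succ']; ring

lemma scaling_bound {f : ℝ → ℝ} {a p : ℝ} (hfc : Continuous f) (ha : 0 < a) (ha1 : a < 1)
    (hf : ∀ t, 0 < t → f (a * t) = a ^ p * f t) :
    ∃ M : ℝ, 0 < M ∧ ∀ t, 0 < t → t ≤ 1 → f t ≤ M * t ^ p := by
  have hcont : ContinuousOn (fun t : ℝ => f t / t ^ p) (Set.Icc a 1) := by
    refine hfc.continuousOn.div (ContinuousOn.rpow_const continuousOn_id fun t ht =>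
      Or.inl (ha.trans_le ht.1).ne') fun t ht => (Real.rpow_pos_of_pos (ha.trans_le ht.1) p).ne'
  obtain ⟨M, hM⟩ := isCompact_Icc.bddAbove_image hcont
  refine ⟨max M 1, by positivity, fun t ht ht1 => ?_⟩
  obtain ⟨n, hn, hn'⟩ := exists_nat_pow_near_of_lt_one ht ht1 ha ha1
  set y := t / a ^ n with hy
  have han : 0 < a ^ n := by positivity
  have hty : t = a ^ n * y := by rw [hy]; field_simp
  have hyI : y ∈ Set.Icc a 1 :=
    ⟨by rw [hy, le_div_iff₀ han, ← pow_succ']; exact hn.le, by rw [hy, div_le_one han]; exact hn'⟩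
  have hy0 : 0 < y := ha.trans_le hyI.1
  have hMy : f y / y ^ p ≤ max M 1 := (hM ⟨y, hyI, rfl⟩).trans (le_max_left _ _)
  rw [div_le_iff₀ (Real.rpow_pos_of_pos hy0 p)] at hMy
  rw [hty, scaling_iterate ha hf n y hy0, Real.mul_rpow han.le hy0.le, ← Real.rpow_natCast a n,
    ← Real.rpow_natCast (a ^ p) n, ← Real.rpow_mul ha.le, ← Real.rpow_mul ha.le, mul_comm (n : ℝ) p]
  have : 0 < a ^ (p * n) := Real.rpow_pos_of_pos ha _
  nlinarith

lemma scaling_exponent_le {f : ℝ → ℝ} {a b p q : ℝ} (hfc : Continuous f)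
    (hf1 : 0 < f 1) (ha : 0 < a) (ha1 : a < 1) (hb : 0 < b) (hb1 : b < 1)
    (hfa : ∀ t, 0 < t → f (a * t) = a ^ p * f t)
    (hfb : ∀ t, 0 < t → f (b * t) = b ^ q * f t) : p ≤ q := by
  by_contra! hlt
  obtain ⟨M, hM, hbound⟩ := scaling_bound hfc ha ha1 hfa
  have hlim : Filter.Tendsto (fun n : ℕ => M * (b ^ (p - q)) ^ n) Filter.atTop (nhds (M * 0)) :=
    (tendsto_pow_atTop_nhds_zero_of_lt_one (Real.rpow_pos_of_pos hb _).le
      (Real.rpow_lt_one hb.le hb1 (sub_pos.2 hlt))).const_mul M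
  rw [mul_zero] at hlim
  refine absurd (ge_of_tendsto' hlim (b := f 1) fun n => ?_) (not_le.2 hf1)
  have h := hbound (b ^ n) (by positivity) (pow_le_one₀ hb.le hb1.le)
  have h' := scaling_iterate hb hfb n 1 one_pos
  rw [mul_one] at h'
  have e : (b ^ n) ^ p = (b ^ (p - q)) ^ n * (b ^ q) ^ n := by
    rw [← mul_pow, ← Real.rpow_add hb, sub_add_cancel, ← Real.rpow_natCast b n,
      ← Real.rpow_natCast _ n, ← Real.rpow_mul hb.le, ← Real.rpow_mul hb.le, mul_comm]
  rw [h', e, ← mul_assoc, mul_comm] at h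
  exact le_of_mul_le_mul_right (by linarith) (pow_pos (Real.rpow_pos_of_pos hb q) n)

/-! ### Real characteristic functions -/

lemma eq_integral_cos {φ : ℝ → ℝ} {μ : Measure ℝ} [IsProbabilityMeasure μ]
    (hφ : ∀ t : ℝ, (φ t : ℂ) = charFunOf μ t) (t : ℝ) : φ t = ∫ x, Real.cos (t * x) ∂μ := by
  have hint : Integrable (fun x : ℝ => Complex.exp (t * x * Complex.I)) μ := by
    refine Integrable.of_bound (by fun_prop) 1 (ae_of_all _ fun x => ?_)
    rw [← Complex.ofReal_mul, Complex.norm_exp_ofReal_mul_I]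
  have h := congrArg Complex.re (hφ t)
  rw [Complex.ofReal_re, charFunOf] at h
  rw [h]
  refine (integral_re hint).symm.trans (integral_congr_ae (ae_of_all _ fun x => ?_))
  simp [← Complex.ofReal_mul, Complex.exp_ofReal_mul_I_re]

lemma integrable_cos_mul (μ : Measure ℝ) [IsProbabilityMeasure μ] (t : ℝ) :
    Integrable (fun x => Real.cos (t * x)) μ :=
  Integrable.of_bound (by fun_prop) 1 (ae_of_all _ fun x => Real.abs_cos_le_one _)

lemma abs_integral_cos_le_one (μ : Measure ℝ) [IsProbabilityMeasure μ] (t : ℝ) :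
    |∫ x, Real.cos (t * x) ∂μ| ≤ 1 := by
  have := norm_integral_le_of_norm_le_const (μ := μ) (f := fun x => Real.cos (t * x)) (C := 1)
    (ae_of_all _ fun x => Real.abs_cos_le_one _)
  simpa using this

lemma continuous_integral_cos (μ : Measure ℝ) [IsProbabilityMeasure μ] :
    Continuous fun t => ∫ x, Real.cos (t * x) ∂μ :=
  continuous_of_dominated (fun t => by fun_prop)
    (fun t => ae_of_all _ fun x => Real.abs_cos_le_one _) (integrable_const 1)
    (ae_of_all _ fun x => by fun_prop)

lemma one_sub_integral_cos (μ : Measure ℝ) [IsProbabilityMeasure μ] (t : ℝ) :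
    1 - ∫ x, Real.cos (t * x) ∂μ = ∫ x, (1 - Real.cos (t * x)) ∂μ := by
  rw [integral_sub (integrable_const 1) (integrable_cos_mul μ t)]
  simp

lemma one_sub_integral_cos_two_mul_le (μ : Measure ℝ) [IsProbabilityMeasure μ] (t : ℝ) :
    1 - ∫ x, Real.cos (2 * t * x) ∂μ ≤ 4 * (1 - ∫ x, Real.cos (t * x) ∂μ) := by
  rw [one_sub_integral_cos, one_sub_integral_cos, ← integral_const_mul]
  refine integral_mono ((integrable_const 1).sub (integrable_cos_mul μ _))
    (((integrable_const 1).sub (integrable_cos_mul μ _)).const_mul 4) fun x => ?_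
  simp only [mul_assoc, Real.cos_two_mul]
  nlinarith [sq_nonneg (1 - Real.cos (t * x))]

lemma integral_cos_eq_one_iff (μ : Measure ℝ) [IsProbabilityMeasure μ] (t : ℝ) :
    ∫ x, Real.cos (t * x) ∂μ = 1 ↔ ∀ᵐ x ∂μ, Real.cos (t * x) = 1 := by
  have h := integral_eq_zero_iff_of_nonneg (μ := μ) (f := fun x => 1 - Real.cos (t * x))
    (fun x => sub_nonneg.2 (Real.cos_le_one _)) ((integrable_const 1).sub (integrable_cos_mul μ t))
  rw [← one_sub_integral_cos, sub_eq_zero, eq_comm] at h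
  rw [h]
  refine ⟨fun H => H.mono fun x hx => (sub_eq_zero.1 hx).symm,
    fun H => H.mono fun x hx => sub_eq_zero.2 hx.symm⟩

/-- The group of points at which a real characteristic function equals `1`. -/
def unitPoints (μ : Measure ℝ) : AddSubgroup ℝ where
  carrier := {t | ∀ᵐ x ∂μ, Real.cos (t * x) = 1}
  zero_mem' := by simp
  add_mem' := by
    intro s t hs ht
    change ∀ᵐ x ∂μ, Real.cos ((s + t) * x) = 1
    filter_upwards [hs, ht] with x hsx htx
    have h := Real.sin_sq_add_cos_sq (s * x)
    rw [hsx] at h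
    have h0 : Real.sin (s * x) = 0 := by nlinarith
    rw [add_mul, Real.cos_add, hsx, htx, h0]
    ring
  neg_mem' := by
    intro t ht
    change ∀ᵐ x ∂μ, Real.cos (-t * x) = 1
    filter_upwards [ht] with x hx
    rw [neg_mul, Real.cos_neg, hx]

/-- A real characteristic function equal to `1` at arbitrarily small positive points is
constant. -/
lemma eq_one_of_frequently_eq_one {φ : ℝ → ℝ} {μ : Measure ℝ} [IsProbabilityMeasure μ]
    (hφ : ∀ t : ℝ, φ t = ∫ x, Real.cos (t * x) ∂μ)
    (h : ∀ ε > 0, ∃ t, 0 < t ∧ t < ε ∧ φ t = 1) (t : ℝ) : φ t = 1 := by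
  have hmem : ∀ t, t ∈ unitPoints μ ↔ φ t = 1 := fun t => by
    rw [hφ, integral_cos_eq_one_iff]; rfl
  have hφc : Continuous φ := by
    rw [funext hφ]; exact continuous_integral_cos μ
  have hdense : Dense (unitPoints μ : Set ℝ) :=
    AddSubgroup.dense_of_not_isolated_zero _ fun ε hε => by
      obtain ⟨t, h0, h1, h2⟩ := h ε hε
      exact ⟨t, (hmem t).2 h2, h0, h1⟩
  exact congrFun (hφc.ext_on hdense continuous_const fun t ht => (hmem t).1 ht) t

/-- If `φ (r t) φ (s t) = φ (c t)` for all `t` and `φ` is a nontrivial real characteristic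
function, then `r < c`. -/
lemma lt_of_mul_eq {φ : ℝ → ℝ} {μ : Measure ℝ} [IsProbabilityMeasure μ]
    (hφ : ∀ t : ℝ, φ t = ∫ x, Real.cos (t * x) ∂μ) (hnt : ∃ t, φ t ≠ 1) {r s c : ℝ}
    (hr : 0 < r) (hs : 0 < s) (hc : 0 ≤ c) (h : ∀ t, φ (r * t) * φ (s * t) = φ (c * t)) :
    r < c := by
  by_contra! hcr
  have hφc : Continuous φ := by
    rw [funext hφ]; exact continuous_integral_cos μ
  have hφ1 : ∀ t, |φ t| ≤ 1 := fun t => hφ t ▸ abs_integral_cos_le_one μ t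
  have hφ0 : φ 0 = 1 := by simp [hφ]
  have hpos : ∀ᶠ t in nhds 0, 0 < φ t :=
    hφc.continuousAt.eventually_const_lt (by rw [hφ0]; exact one_pos)
  obtain ⟨t, ht⟩ := hnt
  refine ht (eq_one_of_frequently_eq_one hφ ?_ t)
  intro ε hε
  rcases hcr.lt_or_eq with hlt | rfl
  · have hq0 : 0 ≤ c / r := by positivity
    have hq1 : c / r < 1 := (div_lt_one hr).2 hlt
    have hstep : ∀ t, |φ (c / r * t)| ≤ |φ t| := by
      intro t
      have h' := h (t / r)
      rw [mul_div_cancel₀ _ hr.ne'] at h'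
      rw [div_mul_eq_mul_div, mul_div_assoc, ← h', abs_mul]
      exact mul_le_of_le_one_right (abs_nonneg _) (hφ1 _)
    have hiter : ∀ (n : ℕ) t, |φ ((c / r) ^ n * t)| ≤ |φ t| := by
      intro n t
      induction n with
      | zero => simp
      | succ n ih => rw [pow_succ', mul_assoc]; exact (hstep _).trans ih
    have hone : ∀ t, 1 ≤ |φ t| := by
      intro t
      have hlim := (tendsto_pow_atTop_nhds_zero_of_lt_one hq0 hq1).mul_const t
      rw [zero_mul] at hlim
      have hlim' := (hφc.abs.tendsto 0).comp hlim
      simp only [hφ0, abs_one] at hlim'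
      exact le_of_tendsto' hlim' fun n => hiter n t
    obtain ⟨δ, hδ, hball⟩ := Metric.eventually_nhds_iff.1 hpos
    have hm : 0 < min δ ε := lt_min hδ hε
    have hp : 0 < φ (min δ ε / 2) := hball (by
      rw [Real.dist_eq, sub_zero, abs_of_pos (by positivity)]
      linarith [min_le_left δ ε])
    refine ⟨min δ ε / 2, by positivity, by linarith [min_le_right δ ε], ?_⟩
    have h1 := hone (min δ ε / 2)
    have h2 := hφ1 (min δ ε / 2)
    rw [abs_of_pos hp] at h1 h2
    linarith
  · have hpos' : ∀ᶠ t in nhds 0, 0 < φ (c * t / s) := by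
      have : Filter.Tendsto (fun t => c * t / s) (nhds 0) (nhds 0) := by
        have hcont : Continuous fun t : ℝ => c * t / s := by fun_prop
        simpa using hcont.tendsto 0
      exact this.eventually hpos
    obtain ⟨δ, hδ, hball⟩ := Metric.eventually_nhds_iff.1 hpos'
    have hm : 0 < min δ ε := lt_min hδ hε
    have hp := hball (show dist (min δ ε / 2) 0 < δ by
      rw [Real.dist_eq, sub_zero, abs_of_pos (by positivity)]
      linarith [min_le_left δ ε])
    refine ⟨min δ ε / 2, by positivity, by linarith [min_le_right δ ε], ?_⟩
    have h' := h (min δ ε / 2 / s)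
    rw [mul_div_cancel₀ _ hs.ne', ← mul_div_assoc] at h'
    exact mul_left_cancel₀ hp.ne' (by rw [h', mul_one])

/-- A continuous function with `φ 0 > 0` and `φ t = φ (a t) φ (b t)` for contractions `a`, `b` is
positive. -/
lemma pos_of_eq_mul {φ : ℝ → ℝ} (hφc : Continuous φ) (hφ0 : 0 < φ 0) {a b : ℝ}
    (ha : 0 < a) (ha1 : a < 1) (hb : 0 < b) (hb1 : b < 1)
    (h : ∀ t, φ t = φ (a * t) * φ (b * t)) (t : ℝ) : 0 < φ t := by
  obtain ⟨δ, hδ, hball⟩ := Metric.eventually_nhds_iff.1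
    (hφc.continuousAt.eventually_const_lt hφ0)
  set q := max a b
  have hq0 : 0 < q := lt_max_of_lt_left ha
  have hn : ∀ (n : ℕ) t, q ^ n * |t| < δ → 0 < φ t := by
    intro n
    induction n with
    | zero => intro t ht; exact hball (by simpa using ht)
    | succ n ih =>
      intro t ht
      have key : ∀ k, 0 < k → k ≤ q → 0 < φ (k * t) := by
        intro k hk hkq
        refine ih _ (lt_of_le_of_lt ?_ ht)
        rw [abs_mul, abs_of_pos hk, pow_succ, mul_assoc]
        gcongr
      rw [h t]
      exact mul_pos (key a ha (le_max_left _ _)) (key b hb (le_max_right _ _))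
  have hlim := (tendsto_pow_atTop_nhds_zero_of_lt_one hq0.le (max_lt ha1 hb1)).mul_const |t|
  rw [zero_mul] at hlim
  obtain ⟨n, hnt⟩ := (hlim.eventually_lt_const hδ).exists
  exact hn n t hnt

/-- The scaling exponent of `-log φ` for a nontrivial real characteristic function `φ` is at most
`2`. -/
lemma scaling_exponent_le_two {φ : ℝ → ℝ} {μ : Measure ℝ} [IsProbabilityMeasure μ]
    (hφ : ∀ t : ℝ, φ t = ∫ x, Real.cos (t * x) ∂μ) (hpos : ∀ t, 0 < φ t) {t₀ a p : ℝ}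
    (ht₀ : 0 < t₀) (hlt : φ t₀ < 1) (ha : 0 < a) (ha1 : a < 1)
    (hf : ∀ t, 0 < t → -Real.log (φ (a * t)) = a ^ p * -Real.log (φ t)) : p ≤ 2 := by
  by_contra! hp
  have hφc : Continuous φ := by
    rw [funext hφ]; exact continuous_integral_cos μ
  obtain ⟨M, hM, hbound⟩ := scaling_bound (f := fun t => -Real.log (φ t))
    (hφc.log fun t => (hpos t).ne').neg ha ha1 hf
  have hiter : ∀ n : ℕ, 1 - φ t₀ ≤ 4 ^ n * (1 - φ ((1 / 2) ^ n * t₀)) := by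
    intro n
    induction n with
    | zero => simp
    | succ n ih =>
      refine ih.trans ?_
      have h := one_sub_integral_cos_two_mul_le μ ((1 / 2) ^ (n + 1) * t₀)
      rw [← hφ, ← hφ, show 2 * ((1 / 2) ^ (n + 1) * t₀) = (1 / 2) ^ n * t₀ by ring] at h
      rw [pow_succ (4 : ℝ) n, mul_assoc]
      gcongr
  have hx : ((1 / 2 : ℝ)) ^ p * 4 < 1 := by
    have : (1 / 2 : ℝ) ^ p < (1 / 2) ^ (2 : ℝ) :=
      Real.rpow_lt_rpow_of_exponent_gt (by norm_num) (by norm_num) hp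
    norm_num at this ⊢
    linarith
  have hlim : Filter.Tendsto (fun n : ℕ => M * t₀ ^ p * ((1 / 2 : ℝ) ^ p * 4) ^ n) Filter.atTop
      (nhds (M * t₀ ^ p * 0)) :=
    (tendsto_pow_atTop_nhds_zero_of_lt_one (by positivity) hx).const_mul _
  have hsmall := (tendsto_pow_atTop_nhds_zero_of_lt_one (r := (1 / 2 : ℝ)) (by norm_num)
    (by norm_num)).mul_const t₀
  rw [zero_mul] at hsmall
  rw [mul_zero] at hlim
  refine absurd (ge_of_tendsto hlim (b := 1 - φ t₀) ?_) (by linarith)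
  filter_upwards [hsmall.eventually_le_const one_pos] with n hn
  refine (hiter n).trans ?_
  have h1 := hbound ((1 / 2) ^ n * t₀) (by positivity) hn
  have h2 := Real.log_le_sub_one_of_pos (hpos ((1 / 2) ^ n * t₀))
  have e : ((1 / 2 : ℝ) ^ n * t₀) ^ p = ((1 / 2) ^ p) ^ n * t₀ ^ p := by
    rw [Real.mul_rpow (by positivity) ht₀.le, ← Real.rpow_natCast _ n, ← Real.rpow_natCast _ n,
      ← Real.rpow_mul (by norm_num), ← Real.rpow_mul (by norm_num), mul_comm (n : ℝ) p]
  rw [e] at h1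
  calc 4 ^ n * (1 - φ ((1 / 2) ^ n * t₀)) ≤ 4 ^ n * (M * (((1 / 2) ^ p) ^ n * t₀ ^ p)) := by
        gcongr; linarith
    _ = _ := by rw [mul_pow]; ring

/-- If `-log φ` scales under a contraction and `φ` is a nontrivial real characteristic function,
then `φ < 1` away from `0`. -/
lemma lt_one_of_scaling {φ : ℝ → ℝ} {μ : Measure ℝ} [IsProbabilityMeasure μ]
    (hφ : ∀ t : ℝ, φ t = ∫ x, Real.cos (t * x) ∂μ) (hnt : ∃ t, φ t ≠ 1) (hpos : ∀ t, 0 < φ t)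
    {a p : ℝ} (ha : 0 < a) (ha1 : a < 1)
    (hf : ∀ t, -Real.log (φ (a * t)) = a ^ p * -Real.log (φ t)) {t : ℝ} (ht : t ≠ 0) :
    φ t < 1 := by
  have hle : φ t ≤ 1 := (abs_le.1 (hφ t ▸ abs_integral_cos_le_one μ t)).2
  refine lt_of_le_of_ne hle fun h1 => ?_
  obtain ⟨t₁, ht₁⟩ := hnt
  refine ht₁ (eq_one_of_frequently_eq_one hφ (fun ε hε => ?_) t₁)
  have habs : φ |t| = 1 := by
    rcases abs_choice t with h | h
    · rw [h, h1]
    · rw [h, ← h1, hφ, hφ]; simp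
  have hlim := (tendsto_pow_atTop_nhds_zero_of_lt_one ha.le ha1).mul_const |t|
  rw [zero_mul] at hlim
  obtain ⟨n, hn⟩ := (hlim.eventually_lt_const hε).exists
  refine ⟨a ^ n * |t|, by positivity, hn, Real.eq_one_of_pos_of_log_eq_zero (hpos _) ?_⟩
  have h := scaling_iterate (f := fun t => -Real.log (φ t)) ha (fun t _ => hf t) n |t|
    (by positivity)
  simpa [habs] using h

/-- Consequences of `φ (r t) φ (s t) = φ (c t)` for a nontrivial real characteristic function. -/
lemma scaling_of_mul_eq {φ : ℝ → ℝ} {μ : Measure ℝ} [IsProbabilityMeasure μ]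
    (hφ : ∀ t : ℝ, φ t = ∫ x, Real.cos (t * x) ∂μ) (hnt : ∃ t, φ t ≠ 1) {r s c : ℝ}
    (hr : 0 < r) (hs : 0 < s) (hc : 0 ≤ c) (h : ∀ t, φ (r * t) * φ (s * t) = φ (c * t)) :
    r < c ∧ s < c ∧ (∀ t, 0 < φ t) ∧ ∃ p : ℝ, 0 < p ∧
      (∀ t, -Real.log (φ (r / c * t)) = (r / c) ^ p * -Real.log (φ t)) ∧
      (∀ t, -Real.log (φ (s / c * t)) = (s / c) ^ p * -Real.log (φ t)) := by
  have hφc : Continuous φ := by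
    rw [funext hφ]; exact continuous_integral_cos μ
  have hφ0 : φ 0 = 1 := by simp [hφ]
  have heven : ∀ t, φ (-t) = φ t := fun t => by simp [hφ]
  have hrc := lt_of_mul_eq hφ hnt hr hs hc h
  have hsc := lt_of_mul_eq hφ hnt hs hr hc fun t => by rw [mul_comm, h]
  have hc0 : 0 < c := hr.trans hrc
  have h' : ∀ t, φ t = φ (r / c * t) * φ (s / c * t) := by
    intro t
    have := h (t / c)
    rw [mul_div_cancel₀ _ hc0.ne'] at this
    rw [← this, div_mul_eq_mul_div, div_mul_eq_mul_div, mul_div_assoc, mul_div_assoc]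
  have hrc0 := div_pos hr hc0
  have hsc0 := div_pos hs hc0
  have hrc1 := (div_lt_one hc0).2 hrc
  have hsc1 := (div_lt_one hc0).2 hsc
  have hpos := pos_of_eq_mul hφc (by rw [hφ0]; exact one_pos) hrc0 hrc1 hsc0 hsc1 h'
  obtain ⟨p, hp, hscale⟩ := exists_scaling_exponent (f := fun t => -Real.log (φ t))
    (hφc.log fun t => (hpos t).ne').neg
    (fun t => neg_nonneg.2 (Real.log_nonpos (hpos t).le
      (abs_le.1 (hφ t ▸ abs_integral_cos_le_one μ t)).2)) hrc0 hrc1 hsc0 hsc1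
    (fun t => by
      rw [h' t, Real.log_mul (hpos _).ne' (hpos _).ne', neg_add])
  have hall : ∀ k, (∀ t, 0 < t → -Real.log (φ (k * t)) = k ^ p * -Real.log (φ t)) →
      ∀ t, -Real.log (φ (k * t)) = k ^ p * -Real.log (φ t) := by
    intro k hk t
    rcases lt_trichotomy t 0 with ht | rfl | ht
    · rw [← heven t, ← heven (k * t), ← mul_neg]
      exact hk _ (neg_pos.2 ht)
    · simp [hφ0]
    · exact hk t ht
  exact ⟨hrc, hsc, hpos, p, hp, hall _ fun t ht => (hscale t ht).1,
    hall _ fun t ht => (hscale t ht).2⟩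

lemma div_abs_rpow_eq {F : ℝ → ℝ} {r c p t : ℝ} (hr : 0 < r) (hc : 0 < c)
    (hF : ∀ t, F (r / c * t) = (r / c) ^ p * F t) :
    F (r * t) / |r * t| ^ p = F (c * t) / |c * t| ^ p := by
  have h := hF (c * t)
  rw [← mul_assoc, div_mul_cancel₀ _ hc.ne', Real.div_rpow hr.le hc.le] at h
  rw [h, abs_mul, abs_mul, abs_of_pos hr, abs_of_pos hc, Real.mul_rpow hr.le (abs_nonneg _),
    Real.mul_rpow hc.le (abs_nonneg _)]
  have h1 := (Real.rpow_pos_of_pos hr p).ne'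
  have h2 := (Real.rpow_pos_of_pos hc p).ne'
  field_simp

lemma rpow_mul_div_abs_rpow {F : ℝ → ℝ} {r p t : ℝ} (hr : 0 < r) :
    r ^ p * (F (r * t) / |r * t| ^ p) = F (r * t) / |t| ^ p := by
  rw [abs_mul, abs_of_pos hr, Real.mul_rpow hr.le (abs_nonneg _)]
  have h1 := (Real.rpow_pos_of_pos hr p).ne'
  field_simp

theorem stmt_8 (c d : ℝ → ℝ → ℝ)
    (hc : ∀ r s : ℝ, 0 ≤ r → 0 ≤ s → 0 ≤ c r s)
    (hd : ∀ r s : ℝ, 0 ≤ r → 0 ≤ s → 0 ≤ d r s)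
    (hZne : ∃ r s : ℝ, 0 < r ∧ 0 < s ∧ d r s = 0)
    (hZnefull : ∃ r s : ℝ, 0 < r ∧ 0 < s ∧ d r s ≠ 0)
    (φ ψ : ℝ → ℝ) (μ ν : Measure ℝ)
    (hμ : IsProbabilityMeasure μ) (hν : IsProbabilityMeasure ν)
    (hφ : ∀ t : ℝ, (φ t : ℂ) = charFunOf μ t)
    (hψ : ∀ t : ℝ, (ψ t : ℂ) = charFunOf ν t)
    (hφnt : ∃ t : ℝ, φ t ≠ 1) (hψnt : ∃ t : ℝ, ψ t ≠ 1)
    (heq : ∀ r s t : ℝ, 0 ≤ r → 0 ≤ s →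
      φ (r * t) * φ (s * t) = φ (c r s * t) * ψ (d r s * t)) :
    ∃ p : ℝ, 0 < p ∧ p ≤ 2 ∧
    ∃ H K : ℝ → ℝ,
      ContinuousOn H {t : ℝ | t ≠ 0} ∧ ContinuousOn K {t : ℝ | t ≠ 0} ∧
      (∀ t : ℝ, t ≠ 0 → 0 < H t) ∧ (∀ t : ℝ, t ≠ 0 → 0 < K t) ∧
      (∀ t : ℝ, t ≠ 0 → H (-t) = H t) ∧ (∀ t : ℝ, t ≠ 0 → K (-t) = K t) ∧
      (∀ t : ℝ, t ≠ 0 → φ t = Real.exp (-(|t| ^ p * H t))) ∧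
      (∀ t : ℝ, t ≠ 0 → ψ t = Real.exp (-(|t| ^ p * K t))) ∧
      (∀ r s : ℝ, 0 < r → 0 < s → d r s = 0 → ∀ t : ℝ, t ≠ 0 →
        H (r * t) = H (s * t) ∧ H (s * t) = H (c r s * t) ∧
        K (r * t) = K (s * t) ∧ K (s * t) = K (c r s * t)) ∧
      (∀ r s : ℝ, 0 < r → 0 < s → 0 < c r s → d r s ≠ 0 → ∀ t : ℝ, t ≠ 0 →
        r ^ p * H (r * t) + s ^ p * H (s * t)
          = (c r s) ^ p * H (c r s * t) + (d r s) ^ p * K (d r s * t)) := by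
  have hφ' := eq_integral_cos hφ
  have hψ' := eq_integral_cos hψ
  have hφc : Continuous φ := by rw [funext hφ']; exact continuous_integral_cos μ
  have hψc : Continuous ψ := by rw [funext hψ']; exact continuous_integral_cos ν
  have hφ0 : φ 0 = 1 := by simp [hφ']
  have hψ0 : ψ 0 = 1 := by simp [hψ']
  have hzero : ∀ r s, 0 < r → 0 < s → d r s = 0 →
      ∀ t, φ (r * t) * φ (s * t) = φ (c r s * t) := by
    intro r s hr hs h0 t
    rw [heq r s t hr.le hs.le, h0, zero_mul, hψ0, mul_one]
  obtain ⟨r₀, s₀, hr₀, hs₀, hd₀⟩ := hZne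
  obtain ⟨hrc₀, -, hpos, p, hp, hfa, -⟩ := scaling_of_mul_eq hφ' hφnt hr₀ hs₀
    (hc r₀ s₀ hr₀.le hs₀.le) (hzero r₀ s₀ hr₀ hs₀ hd₀)
  have hc₀ : 0 < c r₀ s₀ := hr₀.trans hrc₀
  have ha : 0 < r₀ / c r₀ s₀ := div_pos hr₀ hc₀
  have ha1 : r₀ / c r₀ s₀ < 1 := (div_lt_one hc₀).2 hrc₀
  have hlt : ∀ t, t ≠ 0 → φ t < 1 := fun t ht =>
    lt_one_of_scaling hφ' hφnt hpos ha ha1 hfa ht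
  set f : ℝ → ℝ := fun t => -Real.log (φ t) with hf
  set g : ℝ → ℝ := fun t => -Real.log (ψ t) with hg
  have hfc : Continuous f := (hφc.log fun t => (hpos t).ne').neg
  have hf1 : 0 < f 1 := neg_pos.2 (Real.log_neg (hpos 1) (hlt 1 one_ne_zero))
  have hZ : ∀ r s, 0 < r → 0 < s → d r s = 0 → 0 < c r s ∧
      (∀ t, f (r / c r s * t) = (r / c r s) ^ p * f t) ∧
      (∀ t, f (s / c r s * t) = (s / c r s) ^ p * f t) := by
    intro r s hr hs h0
    obtain ⟨hrc, -, -, q, -, hq1, hq2⟩ := scaling_of_mul_eq hφ' hφnt hr hs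
      (hc r s hr.le hs.le) (hzero r s hr hs h0)
    have hc0 : 0 < c r s := hr.trans hrc
    have hb : 0 < r / c r s := div_pos hr hc0
    have hb1 : r / c r s < 1 := (div_lt_one hc0).2 hrc
    have hpq : p = q := le_antisymm
      (scaling_exponent_le hfc hf1 ha ha1 hb hb1 (fun t _ => hfa t) fun t _ => hq1 t)
      (scaling_exponent_le hfc hf1 hb hb1 ha ha1 (fun t _ => hq1 t) fun t _ => hfa t)
    subst hpq
    exact ⟨hc0, hq1, hq2⟩
  obtain ⟨r₁, s₁, hr₁, hs₁, hd₁⟩ := hZnefull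
  have hd₁' : 0 < d r₁ s₁ := lt_of_le_of_ne (hd r₁ s₁ hr₁.le hs₁.le) hd₁.symm
  have hψpos : ∀ t, 0 < ψ t := by
    intro t
    have h := heq r₁ s₁ (t / d r₁ s₁) hr₁.le hs₁.le
    rw [mul_div_cancel₀ _ hd₁] at h
    exact (pos_iff_pos_of_mul_pos (h ▸ mul_pos (hpos _) (hpos _))).1 (hpos _)
  have hlog : ∀ r s, 0 < r → 0 < s → ∀ t,
      f (r * t) + f (s * t) = f (c r s * t) + g (d r s * t) := by
    intro r s hr hs t
    have h := congrArg Real.log (heq r s t hr.le hs.le)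
    rw [Real.log_mul (hpos _).ne' (hpos _).ne', Real.log_mul (hpos _).ne' (hψpos _).ne'] at h
    simp only [hf, hg]
    linarith
  have hgk : ∀ k, (∀ t, f (k * t) = k ^ p * f t) → ∀ t, g (k * t) = k ^ p * g t := by
    intro k hk t
    have h1 := hlog r₁ s₁ hr₁ hs₁ (t / d r₁ s₁)
    have h2 := hlog r₁ s₁ hr₁ hs₁ (k * (t / d r₁ s₁))
    rw [mul_left_comm _ k, mul_left_comm _ k, mul_left_comm _ k, mul_left_comm _ k, hk, hk, hk,
      mul_div_cancel₀ _ hd₁] at h2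
    rw [mul_div_cancel₀ _ hd₁] at h1
    linear_combination k ^ p * h1 - h2
  have hψlt : ∀ t, t ≠ 0 → ψ t < 1 := fun t ht =>
    lt_one_of_scaling hψ' hψnt hψpos ha ha1 (hgk _ hfa) ht
  have hgc : Continuous g := (hψc.log fun t => (hψpos t).ne').neg
  have habs : ∀ t : ℝ, t ≠ 0 → 0 < |t| ^ p := fun t ht => Real.rpow_pos_of_pos (abs_pos.2 ht) p
  have hrpow : ContinuousOn (fun t : ℝ => |t| ^ p) {t | t ≠ 0} :=
    (continuous_abs.rpow_const fun _ => Or.inr hp.le).continuousOn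
  refine ⟨p, hp, scaling_exponent_le_two hφ' hpos one_pos (hlt 1 one_ne_zero) ha ha1
      fun t _ => hfa t, fun t => f t / |t| ^ p, fun t => g t / |t| ^ p,
    hfc.continuousOn.div hrpow fun t ht => (habs t ht).ne',
    hgc.continuousOn.div hrpow fun t ht => (habs t ht).ne',
    fun t ht => div_pos (neg_pos.2 (Real.log_neg (hpos t) (hlt t ht))) (habs t ht),
    fun t ht => div_pos (neg_pos.2 (Real.log_neg (hψpos t) (hψlt t ht))) (habs t ht),
    fun t _ => by simp [hf, hφ'], fun t _ => by simp [hg, hψ'], fun t ht => ?_, fun t ht => ?_,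
    fun r s hr hs h0 t _ => ?_, fun r s hr hs hc0 hd0 t _ => ?_⟩
  · rw [mul_div_cancel₀ _ (habs t ht).ne', neg_neg, Real.exp_log (hpos t)]
  · rw [mul_div_cancel₀ _ (habs t ht).ne', neg_neg, Real.exp_log (hψpos t)]
  · obtain ⟨hc0, hr', hs'⟩ := hZ r s hr hs h0
    have h1 := div_abs_rpow_eq (t := t) hr hc0 hr'
    have h2 := div_abs_rpow_eq (t := t) hs hc0 hs'
    have h3 := div_abs_rpow_eq (t := t) hr hc0 (hgk _ hr')
    have h4 := div_abs_rpow_eq (t := t) hs hc0 (hgk _ hs')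
    exact ⟨h1.trans h2.symm, h2, h3.trans h4.symm, h4⟩
  · have hd0' : 0 < d r s := lt_of_le_of_ne (hd r s hr.le hs.le) hd0.symm
    simp only [rpow_mul_div_abs_rpow hr, rpow_mul_div_abs_rpow hs, rpow_mul_div_abs_rpow hc0,
      rpow_mul_div_abs_rpow hd0']
    rw [← add_div, hlog r s hr hs t, add_div]
end
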